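/- arXiv:1103.5943 — 11 statements merged into one kernel-verified Lean document; each statement's English description precedes it below -/
import Mathlib

section
/- In every MV-algebra, the operation x⊎y := ((x⇒(x*y))⇒y) ⊓ ((y⇒(x*y))⇒x) coincides with the MV-sum: for all x, y one has x⊎y = ∼(∼x * ∼y). -/
/-- In every MV-algebra, the operation
`x ⊎ y := ((x⇒(x*y))⇒y) ⊓ ((y⇒(x*y))⇒x)` coincides with the MV-sum
`x ⊕ y = ∼(∼x * ∼y)` (where `∼x := x ⇒ ⊥`). -/
theorem uplus_eq_oplus_in_MV {α : Type*} [Lattice α] [BoundedOrder α]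
    (mul imp : α → α → α)
    (hcomm : ∀ x y, mul x y = mul y x)
    (hassoc : ∀ x y z, mul (mul x y) z = mul x (mul y z))
    (hone : ∀ x, mul x ⊤ = x)
    (hres : ∀ x y z : α, mul z x ≤ y ↔ z ≤ imp x y)
    (hprel : ∀ x y, imp x y ⊔ imp y x = ⊤)
    (hdiv : ∀ x y, x ⊓ y = mul x (imp x y))
    (hinv : ∀ x, imp (imp x ⊥) ⊥ = x) :
    ∀ x y : α,
      (imp (imp x (mul x y)) y) ⊓ (imp (imp y (mul x y)) x)
        = imp (mul (imp x ⊥) (imp y ⊥)) ⊥ := by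
  have cur : ∀ a b c, imp (mul a b) c = imp a (imp b c) := by
    intro a b c
    apply eq_of_forall_le_iff
    intro z
    rw [← hres, ← hres, ← hres, hassoc]
  have himp : ∀ a b, imp a b = imp (mul a (imp b ⊥)) ⊥ := by
    intro a b
    rw [cur, hinv]
  have mono : ∀ a b c, b ≤ c → imp a b ≤ imp a c := by
    intro a b c h
    rw [← hres]
    exact le_trans ((hres _ _ _).2 le_rfl) h
  have key : ∀ x y, imp (imp x (mul x y)) y = imp (mul (imp x ⊥) (imp y ⊥)) ⊥ := by
    intro x y
    have h1 : imp x (mul x y) = imp (x ⊓ imp y ⊥) ⊥ := by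
      rw [himp x (mul x y), cur x y ⊥, ← hdiv]
    have h2 : imp (imp x (mul x y)) y = imp (imp y ⊥) (x ⊓ imp y ⊥) := by
      rw [h1, himp _ y, hcomm, ← himp]
    have h3 : imp (mul (imp x ⊥) (imp y ⊥)) ⊥ = imp (imp y ⊥) x := by
      rw [hcomm, ← himp]
    rw [h2, h3]
    apply le_antisymm (mono _ _ _ inf_le_left)
    rw [← hres, hcomm, ← hdiv, inf_comm]
  intro x y
  have h := key y x
  rw [hcomm y x, hcomm (imp y ⊥)] at h
  rw [key, h, inf_idem]
end

section
/- If A is a totally ordered Wajsberg hoop with no minimum element, then x⊎y = 1 for all x, y ∈ A, where x⊎y := ((x⇒(x*y))⇒y) ⊓ ((y⇒(x*y))⇒x). -/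
/-- If `A` is a totally ordered Wajsberg hoop with no minimum element, then
`x ⊎ y = 1` for all `x, y ∈ A`, where
`x ⊎ y := ((x⇒(x*y))⇒y) ⊓ ((y⇒(x*y))⇒x)` and in a hoop the meet is
`p ⊓ q = p * (p ⇒ q)`. -/
theorem uplus_eq_one_of_unbounded {α : Type*} (mul imp : α → α → α) (one : α)
    (hcomm : ∀ x y, mul x y = mul y x)
    (hassoc : ∀ x y z, mul (mul x y) z = mul x (mul y z))
    (hone : ∀ x, mul x one = x)
    (hself : ∀ x, imp x x = one)
    (hcurry : ∀ x y z, imp x (imp y z) = imp (mul x y) z)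
    (hdivv : ∀ x y, mul x (imp x y) = mul y (imp y x))
    (hwaj : ∀ x y, imp (imp x y) y = imp (imp y x) x)
    (htot : ∀ x y, imp x y = one ∨ imp y x = one)
    (hnomin : ¬ ∃ a, ∀ x, imp a x = one) :
    ∀ x y : α,
      mul (imp (imp x (mul x y)) y)
          (imp (imp (imp x (mul x y)) y) (imp (imp y (mul x y)) x)) = one := by
  have htop : ∀ p, imp p one = one := by
    intro p
    rcases htot p one with h | h
    · exact h
    · have h1 : mul p (imp p one) = one := by
        rw [hdivv, h, hone]
      have h2 : imp (imp p one) one = one := by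
        have := hcurry (imp p one) p p
        rw [hself, hcomm _ p, h1, h] at this
        exact this
      have h3 := hcurry p (imp p one) one
      rw [h1, h2, hself] at h3
      exact h3
  have hone' : ∀ p, imp one p = p := by
    intro p
    have := hdivv one p
    rw [htop, hone, hcomm, hone] at this
    exact this
  have hcanc : ∀ x y, imp x (mul x y) = y := by
    intro x y
    have h1 : mul x (imp x (mul x y)) = mul x y := by
      rw [hdivv, hcomm x y, ← hcurry, hself, htop, hone]
    generalize imp x (mul x y) = w at h1
    have hz : ∃ z, imp (mul x y) z ≠ one := by
      by_contra hc
      push Not at hc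
      exact hnomin ⟨_, hc⟩
    obtain ⟨z, hz⟩ := hz
    have hy : imp y (imp x z) ≠ one := by
      rw [hcurry, hcomm]; exact hz
    have hw : imp w (imp x z) = imp y (imp x z) := by
      rw [hcurry, hcurry, hcomm w, hcomm y, h1]
    have key : ∀ v, imp v (imp x z) ≠ one → imp (imp v (imp x z)) (imp x z) = v := by
      intro v hv
      rw [hwaj, (htot v (imp x z)).resolve_left hv, hone']
    rw [← key w (hw ▸ hy), hw, key y hy]
  intro x y
  have h2 : imp y (mul x y) = x := by rw [hcomm]; exact hcanc y x
  rw [hcanc, h2, hself, hself, hself, hone]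
end

section
/- If A is a totally ordered Wajsberg hoop with minimum element a, then for all x, y ∈ A one has x⊎y = ((x⇒a)*(y⇒a))⇒a, where x⊎y := ((x⇒(x*y))⇒y) ⊓ ((y⇒(x*y))⇒x); that is, ⊎ coincides with the MV-sum x⊕y = ∼(∼x*∼y) computed with the negation ∼z := z⇒a. -/
/-- If `A` is a totally ordered Wajsberg hoop with minimum element `a`, then
`x ⊎ y = ((x⇒a)*(y⇒a))⇒a` for all `x, y`, i.e. `⊎` coincides with the MV-sum
computed with the negation `∼z := z ⇒ a`.  Here
`x ⊎ y := ((x⇒(x*y))⇒y) ⊓ ((y⇒(x*y))⇒x)` and the hoop meet is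
`p ⊓ q = p * (p ⇒ q)`. -/
theorem uplus_eq_oplus_of_bounded {α : Type*} (mul imp : α → α → α) (one a : α)
    (hcomm : ∀ x y, mul x y = mul y x)
    (hassoc : ∀ x y z, mul (mul x y) z = mul x (mul y z))
    (hone : ∀ x, mul x one = x)
    (hself : ∀ x, imp x x = one)
    (hcurry : ∀ x y z, imp x (imp y z) = imp (mul x y) z)
    (hdivv : ∀ x y, mul x (imp x y) = mul y (imp y x))
    (hwaj : ∀ x y, imp (imp x y) y = imp (imp y x) x)
    (htot : ∀ x y, imp x y = one ∨ imp y x = one)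
    (hmin : ∀ x, imp a x = one) :
    ∀ x y : α,
      mul (imp (imp x (mul x y)) y)
          (imp (imp (imp x (mul x y)) y) (imp (imp y (mul x y)) x))
        = imp (mul (imp x a) (imp y a)) a := by
  have himp1 : ∀ x, imp x one = one := by
    intro x
    rw [← hself a, hcurry, hcomm, ← hcurry, hmin, hself]
  have h1imp : ∀ x, imp one x = x := by
    intro x
    have h := hdivv one x
    rw [himp1, hone, hcomm, hone] at h
    exact h
  have hex : ∀ x y z, imp x (imp y z) = imp y (imp x z) := by
    intro x y z
    rw [hcurry, hcomm, ← hcurry]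
  have hnn : ∀ x, imp (imp x a) a = x := by
    intro x
    rw [hwaj, hmin, h1imp]
  have hcontra : ∀ x z, imp x z = imp (imp z a) (imp x a) := by
    intro x z
    rw [hex, hnn]
  have htriple : ∀ p y, imp (imp (imp p y) y) y = imp p y := by
    intro p y
    rw [hwaj (imp p y) y, hex y p y, hself, himp1, h1imp]
  have key : ∀ x y, imp (imp x (mul x y)) y = imp (mul (imp x a) (imp y a)) a := by
    intro x y
    have h : imp (mul x y) a = imp y (imp x a) := by rw [hex, hcurry]
    rw [hcontra x (mul x y), h, hwaj, htriple, ← hcurry, hnn]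
  intro x y
  have h2 : imp (imp y (mul x y)) x = imp (mul (imp x a) (imp y a)) a := by
    rw [hcomm x y, key, hcomm]
  rw [key, h2, hself, hone]
end

section
/- Let A be a BL-chain and let x, y ∈ A with x ≤ y and y⇒x = x (the situation of two elements lying in different components of the ordinal-sum decomposition of A). Then x⊎y = y = max(x, y), where x⊎y := ((x⇒(x*y))⇒y) ⊓ ((y⇒(x*y))⇒x). -/
/-- Let `A` be a BL-chain and `x ≤ y` with `y ⇒ x = x` (two elements lying in
different components of the ordinal-sum decomposition).  Then
`x ⊎ y = y = max (x, y)`, where `x ⊎ y := ((x⇒(x*y))⇒y) ⊓ ((y⇒(x*y))⇒x)`. -/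
theorem uplus_eq_max_of_different_components {α : Type*}
    [LinearOrder α] [BoundedOrder α]
    (mul imp : α → α → α)
    (hcomm : ∀ x y, mul x y = mul y x)
    (hassoc : ∀ x y z, mul (mul x y) z = mul x (mul y z))
    (hone : ∀ x, mul x ⊤ = x)
    (hres : ∀ x y z : α, mul z x ≤ y ↔ z ≤ imp x y)
    (hprel : ∀ x y, imp x y ⊔ imp y x = ⊤)
    (hdiv : ∀ x y, x ⊓ y = mul x (imp x y))
    (x y : α) (hxy : x ≤ y) (hcomp : imp y x = x) :
    (imp (imp x (mul x y)) y) ⊓ (imp (imp y (mul x y)) x) = y ∧ y = max x y := by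
  have h1 : mul x y = x := by
    have h := hdiv y x
    rw [hcomp, inf_eq_right.mpr hxy] at h
    rw [hcomm]; exact h.symm
  have h2 : imp x x = ⊤ := by
    apply top_unique
    rw [← hres, hcomm, hone]
  have h3 : imp ⊤ y = y := by
    apply le_antisymm
    · have h := (hres ⊤ y (imp ⊤ y)).mpr le_rfl
      rwa [hone] at h
    · rw [← hres, hone]
  rw [h1, h2, h3, hcomp, h2]
  exact ⟨inf_top_eq y, (max_eq_right hxy).symm⟩
end

section
/- Every totally ordered pseudo-perfect Wajsberg hoop is either a cancellative hoop or has a minimum element a such that, for every x, there exists n ≥ 1 with xⁿ = a if and only if there is no n ≥ 1 with (x⇒a)ⁿ = a (i.e., it is the 0-free reduct of a perfect MV-chain). -/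
/-- Powers `xⁿ` in a hoop, w.r.t. the monoid operation `mul` with unit `one`. -/
def hpow {α : Type*} (mul : α → α → α) (one : α) (x : α) : ℕ → α
  | 0 => one
  | n + 1 => mul x (hpow mul one x n)

/-- `x ⊎ y := ((x⇒(x*y))⇒y) ⊓ ((y⇒(x*y))⇒x)`, where in a hoop the meet is
`p ⊓ q = p * (p ⇒ q)`. -/
def hoopUplus {α : Type*} (mul imp : α → α → α) (x y : α) : α :=
  mul (imp (imp x (mul x y)) y)
      (imp (imp (imp x (mul x y)) y) (imp (imp y (mul x y)) x))

/-- Every totally ordered pseudo-perfect Wajsberg hoop is either a cancellative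
hoop or has a minimum element `a` such that for every `x` there is `n ≥ 1` with
`xⁿ = a` iff there is no `n ≥ 1` with `(x⇒a)ⁿ = a` (i.e. it is the `0`-free
reduct of a perfect MV-chain). -/
theorem toWajsberg_pseudoPerfect_cancellative_or_perfect {α : Type*}
    (mul imp : α → α → α) (one : α)
    (hcomm : ∀ x y, mul x y = mul y x)
    (hassoc : ∀ x y z, mul (mul x y) z = mul x (mul y z))
    (hone : ∀ x, mul x one = x)
    (hself : ∀ x, imp x x = one)
    (hcurry : ∀ x y z, imp x (imp y z) = imp (mul x y) z)
    (hdivv : ∀ x y, mul x (imp x y) = mul y (imp y x))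
    (hwaj : ∀ x y, imp (imp x y) y = imp (imp y x) x)
    (htot : ∀ x y, imp x y = one ∨ imp y x = one)
    (hps : ∀ x, mul (hoopUplus mul imp x x) (hoopUplus mul imp x x)
        = hoopUplus mul imp (mul x x) (mul x x)) :
    (∀ x y, imp y (mul x y) = x) ∨
      ∃ a : α, (∀ x, imp a x = one) ∧
        (∀ x, (∃ n, 1 ≤ n ∧ hpow mul one x n = a) ↔
          ¬ ∃ n, 1 ≤ n ∧ hpow mul one (imp x a) n = a) := by
  have hone' : ∀ x, mul one x = x := fun x => by rw [hcomm, hone]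
  have anti : ∀ x y, imp x y = one → imp y x = one → x = y := by
    intro x y h1 h2
    have := hdivv x y
    rwa [h1, h2, hone, hone] at this
  have oneimp : ∀ x, imp one x = x := by
    intro x
    apply anti
    · have := hself (imp one x)
      rwa [hcurry, hone] at this
    · rw [hcurry, hone, hself]
  have impone : ∀ x, imp x one = one := by
    intro x
    rcases htot x one with h | h
    · exact h
    · rw [oneimp] at h
      rw [h, hself]
  have trans : ∀ x y z, imp x y = one → imp y z = one → imp x z = one := by
    intro x y z h1 h2
    have h := hdivv x y
    rw [h1, hone, hcomm] at h
    rw [h, ← hcurry, h2, impone]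
  have mono : ∀ x y z, imp x y = one → imp (mul x z) (mul y z) = one := by
    intro x y z h
    rw [← hcurry]
    apply trans _ _ _ h
    rw [hcurry, hself]
  have dn : ∀ c z, imp c z = one → imp (imp z c) c = z := by
    intro c z h
    rw [hwaj, h, oneimp]
  have mulle : ∀ x y, imp (mul x y) y = one := by
    intro x y
    rw [← hcurry, hself, impone]
  have mulle' : ∀ x y, imp (mul x y) x = one := by
    intro x y
    rw [hcomm, mulle]
  have canc : ∀ c x y, imp c (mul x y) = one → imp (mul x y) c ≠ one →
      imp y (mul x y) = x := by
    intro c x y h1 h2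
    have e : imp (mul x y) c = imp y (imp x c) := by rw [hcurry, hcomm]
    rw [← dn c (mul x y) h1, hcurry, e]
    rcases htot y (imp x c) with h | h
    · exact absurd (e.trans h) h2
    · rw [hdivv, h, hone]
      exact dn c x (trans _ _ _ h1 (mulle' x y))
  by_cases hc : ∀ x y, imp y (mul x y) = x
  · exact Or.inl hc
  right
  push Not at hc
  obtain ⟨x0, y0, h0⟩ := hc
  obtain ⟨a, ha⟩ : ∃ a, a = mul x0 y0 := ⟨_, rfl⟩
  have hmin : ∀ x, imp a x = one := by
    intro c
    by_contra hn
    rcases htot a c with h | h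
    · exact hn h
    · subst ha
      exact h0 (canc c x0 y0 h hn)
  have hle : ∀ x, imp x a = one → x = a := fun x h => anti _ _ h (hmin x)
  have hne : one ≠ a := by
    intro h
    have all : ∀ x, x = one := by
      intro x
      have := hmin x
      rwa [← h, oneimp] at this
    exact h0 ((all _).trans (all _).symm)
  have amul : ∀ x, mul a x = a := fun x => hle _ (mulle' a x)
  have mula : ∀ x, mul x a = a := fun x => hle _ (mulle x a)
  have C : ∀ x y, mul x y ≠ a → imp y (mul x y) = x := fun x y h =>
    canc a x y (hmin _) (fun h' => h (hle _ h'))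
  have ps : ∀ x, mul (imp (imp x (mul x x)) x) (imp (imp x (mul x x)) x)
      = imp (imp (mul x x) (mul (mul x x) (mul x x))) (mul x x) := by
    intro x
    have := hps x
    simpa only [hoopUplus, hself, hone] using this
  have mulN : ∀ x, mul x (imp x a) = a := by
    intro x
    rw [hdivv, amul]
  have h1 : ∀ x, mul x x = a → mul (imp (imp x a) x) (imp (imp x a) x) = a := by
    intro x h
    have := ps x
    rwa [h, amul, hself, oneimp] at this
  have nofix : ∀ y, imp y a ≠ y := by
    intro y h
    have h2 := mulN y
    rw [h] at h2
    have := h1 y h2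
    rw [h, hself, hone] at this
    exact hne this
  have h2 : ∀ x, mul x x ≠ a → mul (mul x x) (mul x x) ≠ a := by
    intro x h h4
    have := ps x
    rw [C x x h, hself, hone, h4] at this
    apply nofix (mul x x)
    apply anti _ _ this.symm
    rw [hcurry, h4, hself]
  have psq : ∀ x n, hpow mul one (mul x x) n = mul (hpow mul one x n) (hpow mul one x n) := by
    intro x n
    induction n with
    | zero => simp [hpow, hone]
    | succ k ih =>
      simp only [hpow]
      rw [ih]
      rw [hassoc, hassoc, ← hassoc x (hpow mul one x k), hcomm x (hpow mul one x k), hassoc, hcomm x (hpow mul one x k)]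
  have hp : ∀ n x, mul x x ≠ a → hpow mul one x n ≠ a := by
    intro n
    induction n with
    | zero => intro x _; exact hne
    | succ n ih =>
      intro x hx h
      cases n with
      | zero =>
        simp only [hpow, hone] at h
        exact hx (by rw [h, amul])
      | succ k =>
        apply ih (mul x x) (h2 x hx)
        rw [psq]
        have e : mul (hpow mul one x (k+1)) (hpow mul one x (k+1))
            = mul (hpow mul one x (k+1+1)) (hpow mul one x k) := by
          simp only [hpow]
          rw [← hassoc, hcomm (mul x (hpow mul one x k)) x]
        rw [e, h, amul]
  have key : ∀ x, (∃ n, 1 ≤ n ∧ hpow mul one x n = a) ↔ mul x x = a := by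
    intro x
    constructor
    · rintro ⟨n, _, h⟩
      by_contra hx
      exact hp n x hx h
    · intro h
      exact ⟨2, by norm_num, by simp only [hpow, hone, h]⟩
  refine ⟨a, hmin, fun x => ?_⟩
  rw [key, key]
  constructor
  · intro hx hN
    apply nofix x
    apply anti
    · have : imp (imp x a) (imp (imp x a) a) = one := by rw [hcurry, hN, hself]
      rwa [dn a x (hmin x)] at this
    · rw [hcurry, hx, hself]
  · intro hN
    rcases htot x (imp x a) with h | h
    · rw [hcurry] at h
      exact hle _ h
    · exfalso
      apply hN
      have := mono _ _ (imp x a) h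
      rw [mulN] at this
      exact hle _ this
end

section
/- Every perfect MV-chain satisfies the identity (x⊕x)*(x⊕x) = (x*x)⊕(x*x) for all x (so every perfect MV-chain lies in the variety generated by Chang's MV-algebra). -/
/-- Every perfect MV-chain satisfies `(x⊕x)*(x⊕x) = (x*x)⊕(x*x)` for all `x`
(so every perfect MV-chain lies in the variety generated by Chang's
MV-algebra).  Here `∼x := x ⇒ ⊥` and `x ⊕ y := ∼(∼x * ∼y)`. -/
theorem perfect_MV_chain_satisfies_chang {α : Type*}
    [LinearOrder α] [BoundedOrder α]
    (mul imp : α → α → α)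
    (hcomm : ∀ x y, mul x y = mul y x)
    (hassoc : ∀ x y z, mul (mul x y) z = mul x (mul y z))
    (hone : ∀ x, mul x ⊤ = x)
    (hres : ∀ x y z : α, mul z x ≤ y ↔ z ≤ imp x y)
    (hprel : ∀ x y, imp x y ⊔ imp y x = ⊤)
    (hdiv : ∀ x y, x ⊓ y = mul x (imp x y))
    (hinv : ∀ x, imp (imp x ⊥) ⊥ = x)
    (hperf : ∀ x : α, (∃ n, 1 ≤ n ∧ hpow mul (⊤ : α) x n = ⊥) ↔
      ¬ ∃ n, 1 ≤ n ∧ hpow mul (⊤ : α) (imp x ⊥) n = ⊥) :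
    ∀ x : α,
      mul (imp (mul (imp x ⊥) (imp x ⊥)) ⊥) (imp (mul (imp x ⊥) (imp x ⊥)) ⊥)
        = imp (mul (imp (mul x x) ⊥) (imp (mul x x) ⊥)) ⊥ := by
  have hmono : ∀ a b c : α, a ≤ b → mul a c ≤ mul b c := fun a b c h =>
    (hres c _ a).2 (h.trans ((hres c _ b).1 le_rfl))
  have hmono2 : ∀ a b c d : α, a ≤ b → c ≤ d → mul a c ≤ mul b d := fun a b c d h h' =>
    (hmono a b c h).trans (by rw [hcomm b c, hcomm b d]; exact hmono c d b h')
  have hpm : ∀ a b : α, a ≤ b → ∀ n, hpow mul ⊤ a n ≤ hpow mul ⊤ b n := by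
    intro a b h n
    induction n with
    | zero => exact le_rfl
    | succ k ih => exact hmono2 _ _ _ _ h ih
  have hsq : ∀ a : α, ∀ n, hpow mul ⊤ (mul a a) n = hpow mul ⊤ a (2 * n) := by
    intro a n
    induction n with
    | zero => rfl
    | succ k ih =>
      change mul (mul a a) _ = mul a (mul a (hpow mul ⊤ a (2 * k)))
      rw [ih, hassoc]
  have key : ∀ a : α, (∃ n, 1 ≤ n ∧ hpow mul (⊤ : α) a n = ⊥) → mul a a = ⊥ := by
    intro a ha
    rcases le_total a (imp a ⊥) with h | h
    · exact le_bot_iff.1 ((hres a ⊥ a).2 h)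
    · obtain ⟨n, hn, h0⟩ := ha
      exact absurd ⟨n, hn, le_bot_iff.1 (h0 ▸ hpm _ _ h n)⟩ ((hperf a).1 ⟨n, hn, h0⟩)
  have nsq : ∀ a : α, (∃ n, 1 ≤ n ∧ hpow mul (⊤ : α) (mul a a) n = ⊥) →
      (∃ n, 1 ≤ n ∧ hpow mul (⊤ : α) a n = ⊥) := by
    rintro a ⟨n, hn, h⟩
    exact ⟨2 * n, by omega, by rw [← hsq, h]⟩
  have nbot : imp ⊥ ⊥ = (⊤ : α) := top_le_iff.1 ((hres ⊥ ⊥ ⊤).1 (by rw [hcomm, hone]))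
  have ntop : imp ⊤ ⊥ = (⊥ : α) := by
    have := hinv ⊥
    rwa [nbot] at this
  intro x
  by_cases hx : ∃ n, 1 ≤ n ∧ hpow mul (⊤ : α) x n = ⊥
  · rw [key x hx, nbot, hone, ntop]
    apply key
    rw [hperf, hinv]
    exact fun h => (hperf x).1 hx (nsq _ h)
  · have hn : ∃ n, 1 ≤ n ∧ hpow mul (⊤ : α) (imp x ⊥) n = ⊥ := by
      rw [hperf, hinv]; exact hx
    rw [key _ hn, nbot, hone, key (imp (mul x x) ⊥), nbot]
    rw [hperf, hinv]
    exact fun h => hx (nsq _ h)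
end

section
/- Every finite BL-chain satisfying the identity (x⊎x)*(x⊎x) = (x*x)⊎(x*x) is a Gödel chain: its monoid operation is idempotent, i.e. x*x = x for all x, and consequently x*y = x⊓y for all x, y. -/
/-- `x ⊎ y := ((x⇒(x*y))⇒y) ⊓ ((y⇒(x*y))⇒x)`. -/
def blUplus {α : Type*} [Lattice α] (mul imp : α → α → α) (p q : α) : α :=
  (imp (imp p (mul p q)) q) ⊓ (imp (imp q (mul p q)) p)

/-- Every finite BL-chain satisfying the identity `(x⊎x)*(x⊎x) = (x*x)⊎(x*x)`
is a Gödel chain: its monoid operation is idempotent, `x*x = x` for all `x`,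
and consequently `x*y = x ⊓ y` for all `x, y`. -/
theorem finite_BLChang_chain_is_Godel {α : Type*}
    [LinearOrder α] [BoundedOrder α] [Finite α]
    (mul imp : α → α → α)
    (hcomm : ∀ x y, mul x y = mul y x)
    (hassoc : ∀ x y z, mul (mul x y) z = mul x (mul y z))
    (hone : ∀ x, mul x ⊤ = x)
    (hres : ∀ x y z : α, mul z x ≤ y ↔ z ≤ imp x y)
    (hprel : ∀ x y, imp x y ⊔ imp y x = ⊤)
    (hdiv : ∀ x y, x ⊓ y = mul x (imp x y))
    (hcha : ∀ x : α, mul (blUplus mul imp x x) (blUplus mul imp x x)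
        = blUplus mul imp (mul x x) (mul x x)) :
    (∀ x : α, mul x x = x) ∧ (∀ x y : α, mul x y = x ⊓ y) := by
  have hmt : ∀ x y : α, imp x y = ⊤ ↔ x ≤ y := fun x y => by
    rw [← top_le_iff, ← hres, hcomm, hone]
  have hle : ∀ x y : α, mul x y ≤ x := fun x y => by
    rw [hcomm, hres, (hmt x x).2 le_rfl]; exact le_top
  have hU : ∀ x : α, blUplus mul imp x x = ⊤ ↔ imp x (mul x x) ≤ x := fun x => by
    simp only [blUplus, inf_idem]; exact hmt _ _
  have htt : mul ⊤ ⊤ = (⊤ : α) := hone ⊤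
  have hS : ∀ x : α, imp x (mul x x) ≤ x → mul x x = x := by
    intro x
    induction x using WellFoundedLT.induction with
    | ind x ih =>
      intro hx
      by_contra hne
      have hlt : mul x x < x := lt_of_le_of_ne (hle x x) hne
      have h1 := hcha x
      rw [(hU x).2 hx, htt] at h1
      have h2 := (hU _).1 h1.symm
      have h3 := ih _ hlt h2
      rw [h3, (hmt _ _).2 le_rfl, top_le_iff] at h2
      rw [h2] at hlt
      exact not_top_lt hlt
  have hid : ∀ x : α, mul x x = x := by
    intro x
    by_contra hne
    have hx : x < imp x (mul x x) := by
      by_contra h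
      exact hne (hS x (not_lt.1 h))
    have hy : mul x (imp x (mul x x)) = mul x x := by
      rw [← hdiv]; exact inf_eq_right.2 (hle x x)
    set y := imp x (mul x x) with hydef
    obtain ⟨t, ht⟩ : ∃ t, x = mul y t :=
      ⟨imp y x, by rw [← hdiv]; exact (inf_eq_right.2 hx.le).symm⟩
    have hyx : mul (mul y y) t = mul x x := by
      rw [hassoc, ← ht, hcomm, hy]
    have hz : imp y (mul y y) ≤ y := by
      rw [hydef, ← hres, ← hydef]
      have e : mul (imp y (mul y y)) x = mul x x := by
        rw [← hyx]
        conv_lhs => rw [ht]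
        rw [← hassoc, hcomm (imp y (mul y y)) y, ← hdiv, inf_eq_right.2 (hle y y)]
      exact e.le
    have hyy := hS y hz
    rw [hyy, ← ht] at hyx
    exact hne hyx.symm
  have hmono : ∀ x y z : α, x ≤ y → mul x z ≤ mul y z := fun x y z h => by
    rw [hres]; exact h.trans ((hres _ _ _).1 le_rfl)
  refine ⟨hid, fun x y => le_antisymm (le_inf (hle x y) (by rw [hcomm]; exact hle y x)) ?_⟩
  calc x ⊓ y = mul (x ⊓ y) (x ⊓ y) := (hid _).symm
    _ ≤ mul x (x ⊓ y) := hmono _ _ _ inf_le_left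
    _ = mul (x ⊓ y) x := hcomm _ _
    _ ≤ mul y x := hmono _ _ _ inf_le_right
    _ = mul x y := hcomm _ _
end

section
/- Let A be a BL-algebra with 0 ≠ 1 satisfying the identity (x⊎x)*(x⊎x) = (x*x)⊎(x*x), and suppose A is simple, i.e. its only filters are {1} and A. Then A has exactly two elements (A is the two-element Boolean algebra 2). -/
/-- Let `A` be a BL-algebra with `0 ≠ 1` satisfying the identity
`(x⊎x)*(x⊎x) = (x*x)⊎(x*x)`, and suppose `A` is simple, i.e. its only filters
are `{1}` and `A`.  Then `A` has exactly two elements: every element is `⊥` or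
`⊤` (so `A` is the two-element Boolean algebra `2`). -/
theorem simple_BLChang_is_two {α : Type*} [Lattice α] [BoundedOrder α]
    (mul imp : α → α → α)
    (hcomm : ∀ x y, mul x y = mul y x)
    (hassoc : ∀ x y z, mul (mul x y) z = mul x (mul y z))
    (hone : ∀ x, mul x ⊤ = x)
    (hres : ∀ x y z : α, mul z x ≤ y ↔ z ≤ imp x y)
    (hprel : ∀ x y, imp x y ⊔ imp y x = ⊤)
    (hdiv : ∀ x y, x ⊓ y = mul x (imp x y))
    (hnontriv : (⊥ : α) ≠ ⊤)
    (hcha : ∀ x : α, mul (blUplus mul imp x x) (blUplus mul imp x x)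
        = blUplus mul imp (mul x x) (mul x x))
    (hsimple : ∀ F : Set α, (⊤ : α) ∈ F →
      (∀ x ∈ F, ∀ y ∈ F, mul x y ∈ F) →
      (∀ x ∈ F, ∀ y, x ≤ y → y ∈ F) →
      F = {(⊤ : α)} ∨ F = Set.univ) :
    ∀ x : α, x = ⊥ ∨ x = ⊤ := by
  have mono : ∀ a b c d : α, a ≤ b → c ≤ d → mul a c ≤ mul b d := by
    have m1 : ∀ a b c : α, a ≤ b → mul a c ≤ mul b c := fun a b c h =>
      (hres _ _ _).2 (h.trans ((hres _ _ _).1 le_rfl))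
    intro a b c d h1 h2
    refine (m1 a b c h1).trans ?_
    rw [hcomm b c, hcomm b d]
    exact m1 _ _ _ h2
  have mle : ∀ a b : α, mul a b ≤ a := fun a b => by
    have := mono a a b ⊤ le_rfl le_top
    rwa [hone] at this
  have imp_top : ∀ a b : α, a ≤ b → imp a b = ⊤ := fun a b h =>
    top_le_iff.1 ((hres _ _ _).1 (by rw [hcomm, hone]; exact h))
  let p : α → ℕ → α := fun x n => Nat.rec x (fun _ a => mul a a) n
  have p0 : ∀ x, p x 0 = x := fun _ => rfl
  have ps : ∀ x n, p x (n+1) = mul (p x n) (p x n) := fun _ _ => rfl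
  have panti : ∀ x, Antitone (p x) := fun x =>
    antitone_nat_of_succ_le (fun n => by rw [ps]; exact mle _ _)
  have nilp : ∀ x, x ≠ ⊤ → ∃ n, p x n = ⊥ := by
    intro x hx
    have h1 : ∀ a ∈ {a | ∃ n, p x n ≤ a}, ∀ b ∈ {a | ∃ n, p x n ≤ a},
        mul a b ∈ {a | ∃ n, p x n ≤ a} := by
      rintro a ⟨n, hn⟩ b ⟨m, hm⟩
      refine ⟨max n m + 1, ?_⟩
      rw [ps]
      exact mono _ _ _ _ ((panti x (le_max_left n m)).trans hn)
        ((panti x (le_max_right n m)).trans hm)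
    have h2 : ∀ a ∈ {a | ∃ n, p x n ≤ a}, ∀ b, a ≤ b → b ∈ {a | ∃ n, p x n ≤ a} := by
      rintro a ⟨n, hn⟩ b hab
      exact ⟨n, hn.trans hab⟩
    rcases hsimple {a | ∃ n, p x n ≤ a} ⟨0, le_top⟩ h1 h2 with h | h
    · exfalso
      apply hx
      have : x ∈ {a | ∃ n, p x n ≤ a} := ⟨0, le_rfl⟩
      rw [h] at this
      exact this
    · have : (⊥ : α) ∈ {a | ∃ n, p x n ≤ a} := by rw [h]; trivial
      obtain ⟨n, hn⟩ := this
      exact ⟨n, le_bot_iff.1 hn⟩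
  have key : ∀ y, y ≠ ⊤ → blUplus mul imp y y ≠ ⊤ := by
    intro y hy hu
    have all : ∀ n, blUplus mul imp (p y n) (p y n) = ⊤ := by
      intro n
      induction n with
      | zero => exact hu
      | succ n ih => rw [ps, ← hcha, ih, hone]
    obtain ⟨n, hn⟩ := nilp y hy
    have h := all n
    rw [hn] at h
    unfold blUplus at h
    rw [inf_idem, imp_top ⊥ _ bot_le] at h
    have h2 := (hres ⊤ ⊥ ⊤).2 h.ge
    rw [hone] at h2
    exact hnontriv (le_bot_iff.1 h2).symm
  intro x
  by_contra hcon
  push Not at hcon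
  obtain ⟨hx0, hx1⟩ := hcon
  obtain ⟨z, hz0, hzz⟩ : ∃ z : α, z ≠ ⊥ ∧ mul z z = ⊥ := by
    obtain ⟨n, hn⟩ := nilp x hx1
    induction n with
    | zero => exact absurd hn hx0
    | succ n ih =>
      by_cases h : p x n = ⊥
      · exact ih h
      · exact ⟨p x n, h, hn⟩
  have hzy : z ≤ imp z ⊥ := (hres _ _ _).1 hzz.le
  have hyz : mul (imp z ⊥) z = ⊥ := le_bot_iff.1 ((hres _ _ _).2 le_rfl)
  have hy1 : imp z ⊥ ≠ ⊤ := by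
    intro h
    rw [h, hcomm, hone] at hyz
    exact hz0 hyz
  generalize hy : imp z ⊥ = y at *
  apply key y hy1
  unfold blUplus
  rw [inf_idem]
  apply imp_top
  rw [← hy, ← hres]
  rw [hy]
  have e1 : mul y (imp y (mul y y)) = mul y y := by
    rw [← hdiv]; exact inf_eq_right.2 (mle _ _)
  have e2 : z = mul y (imp y z) := by
    rw [← hdiv]; exact (inf_eq_right.2 hzy).symm
  have e3 : mul (imp y (mul y y)) z = mul y z := by
    calc mul (imp y (mul y y)) z = mul (imp y (mul y y)) (mul y (imp y z)) := by rw [← e2]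
      _ = mul (mul y (imp y (mul y y))) (imp y z) := by rw [← hassoc, hcomm _ y]
      _ = mul y z := by rw [e1, hassoc, ← e2]
  rw [e3, hyz]
end

section
/- Every BL-chain satisfying the identity (x⊎x)*(x⊎x) = (x*x)⊎(x*x) also satisfies the identity ∼((∼(x*x))*(∼(x*x))) = (∼((∼x)*(∼x)))*(∼((∼x)*(∼x))); that is, every BL_Chang-chain belongs to the variety P₀ generated by perfect BL-algebras. -/
/-- Every BL-chain satisfying the identity `(x⊎x)*(x⊎x) = (x*x)⊎(x*x)` also
satisfies `∼((∼(x*x))*(∼(x*x))) = (∼((∼x)*(∼x)))*(∼((∼x)*(∼x)))` (with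
`∼x := x ⇒ ⊥`); that is, every BL_Chang-chain belongs to the variety `P₀`
generated by perfect BL-algebras. -/
theorem BLChang_chain_in_P0 {α : Type*} [LinearOrder α] [BoundedOrder α]
    (mul imp : α → α → α)
    (hcomm : ∀ x y, mul x y = mul y x)
    (hassoc : ∀ x y z, mul (mul x y) z = mul x (mul y z))
    (hone : ∀ x, mul x ⊤ = x)
    (hres : ∀ x y z : α, mul z x ≤ y ↔ z ≤ imp x y)
    (hprel : ∀ x y, imp x y ⊔ imp y x = ⊤)
    (hdiv : ∀ x y, x ⊓ y = mul x (imp x y))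
    (hcha : ∀ x : α, mul (blUplus mul imp x x) (blUplus mul imp x x)
        = blUplus mul imp (mul x x) (mul x x)) :
    ∀ x : α,
      imp (mul (imp (mul x x) ⊥) (imp (mul x x) ⊥)) ⊥
        = mul (imp (mul (imp x ⊥) (imp x ⊥)) ⊥)
              (imp (mul (imp x ⊥) (imp x ⊥)) ⊥) := by
  have hle : ∀ x y z : α, z ≤ imp x y → mul z x ≤ y := fun x y z => (hres x y z).2
  have hge : ∀ x y z : α, mul z x ≤ y → z ≤ imp x y := fun x y z => (hres x y z).1
  have hcur : ∀ a b c : α, imp (mul a b) c = imp a (imp b c) := by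
    intro a b c
    apply le_antisymm
    · apply hge; apply hge; rw [hassoc]; exact hle _ _ _ le_rfl
    · apply hge; rw [← hassoc]; exact hle _ _ _ (hle _ _ _ le_rfl)
  have htop : ∀ a b : α, a ≤ b → imp a b = ⊤ := by
    intro a b h
    apply top_le_iff.1
    apply hge; rw [hcomm, hone]; exact h
  have hti : ∀ b : α, imp ⊤ b = b := by
    intro b
    have := hdiv ⊤ b
    rw [hcomm, hone, top_inf_eq] at this
    exact this.symm
  have hanti : ∀ a : α, mul (imp a ⊥) a = ⊥ := fun a => le_bot_iff.1 (hle _ _ _ le_rfl)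
  have hdn : ∀ a : α, a ≤ imp (imp a ⊥) ⊥ := by
    intro a; apply hge; rw [hcomm]; exact hle _ _ _ le_rfl
  have hmono : ∀ a b c : α, a ≤ b → mul a c ≤ mul b c := by
    intro a b c h
    apply hle; exact h.trans (hge _ _ _ le_rfl)
  have hbot : ∀ a : α, mul a ⊥ = ⊥ := by
    intro a; apply le_bot_iff.1; apply hle; rw [htop _ _ le_rfl]; exact le_top
  have hinv : ∀ x : α, imp x ⊥ ≠ ⊥ → imp (imp x ⊥) ⊥ = x := by
    intro x hx
    obtain ⟨n, hn⟩ : ∃ n, n = imp x ⊥ := ⟨_, rfl⟩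
    obtain ⟨z, hz⟩ : ∃ z, z = imp n ⊥ := ⟨_, rfl⟩
    obtain ⟨t, ht⟩ : ∃ t, t = imp z x := ⟨_, rfl⟩
    rw [← hn] at hx ⊢
    rw [← hz]
    have hxz : x ≤ z := by rw [hz, hn]; exact hdn x
    have hzt : x = mul z t := by rw [ht, ← hdiv, inf_eq_right.2 hxz]
    have hzn : imp z ⊥ = n := by
      apply le_antisymm
      · rw [hn]; apply hge
        exact (by rw [hcomm (imp z ⊥), hcomm (imp z ⊥)]; exact hmono _ _ _ hxz : mul (imp z ⊥) x ≤ mul (imp z ⊥) z).trans (hanti z).le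
      · rw [hz]; exact hdn n
    have htn : imp t n = n := by
      rw [← hzn, ← hcur, hcomm t z, ← hzt, hzn, hn]
    rcases le_total t n with h | h
    · rw [htop _ _ h] at htn
      have hz0 : z = ⊥ := by rw [hz, ← htn, hti]
      rw [hz0] at hxz ⊢
      exact (le_bot_iff.1 hxz).symm
    · have hn2 : n = mul t n := by
        have := hdiv t n
        rwa [htn, inf_eq_right.2 h] at this
      rcases le_total z t with h' | h'
      · have : imp t z = z := by rw [hz, ← hcur, ← hn2]
        have h2 := hdiv t z
        rw [this, inf_eq_right.2 h', hcomm, ← hzt] at h2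
        exact h2
      · exfalso; apply hx
        rw [hn2]
        apply le_bot_iff.1
        apply hle; rw [← hz]; exact h'
  have hkey : ∀ y : α, mul y y = ⊥ → mul (imp (imp y ⊥) y) (imp (imp y ⊥) y) = ⊥ := by
    intro y hy
    have := hcha y
    simp only [blUplus, inf_idem, hy, hbot] at this
    rw [this, htop ⊥ ⊥ le_rfl, hti]
  intro x
  by_cases hx : imp x ⊥ = ⊥
  · simp only [hcur, hx, hbot, htop ⊥ ⊥ le_rfl, hone]
    try simp [htop ⊥ _ bot_le, hone]
  · have hi := hinv x hx
    rcases le_total x (imp x ⊥) with h | h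
    · have hxx : mul x x = ⊥ := le_bot_iff.1 (hle _ _ _ h)
      have hk := hkey x hxx
      rw [hcur (imp x ⊥), hi, hk, hxx, htop ⊥ ⊥ le_rfl, hone, hti]
    · have hyy : mul (imp x ⊥) (imp x ⊥) = ⊥ := by
        apply le_bot_iff.1; apply hle; rw [hi]; exact h
      have hk := hkey _ hyy
      rw [hi] at hk
      rw [hcur x x, hk, hyy, htop ⊥ ⊥ le_rfl, hone]
end

section
/- Every countable totally ordered cancellative hoop partially embeds into the standard cancellative hoop (0,1]_C: for every finite subset F of a countable totally ordered cancellative hoop H there is an injective map f : F → (0,1] such that f(1) = 1 whenever 1 ∈ F, f(x*y) = f(x)·f(y) whenever x, y, x*y ∈ F, and f(x⇒y) = min(1, f(y)/f(x)) whenever x, y, x⇒y ∈ F. -/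
theorem hoopaux_weights {Γ : Type*} [LinearOrder Γ] (C : Finset Γ) :
    ∀ V : Finset (Γ → ℝ), ∃ w : Γ → ℝ, ∀ v ∈ V,
      (∃ c ∈ C, (∀ j < c, v j = 0) ∧ 0 < v c) → 0 < ∑ c ∈ C, w c * v c := by
  classical
  induction C using Finset.induction_on_min with
  | empty => intro V; exact ⟨0, by simp⟩
  | insert a s has ih =>
    intro V
    obtain ⟨w, hw⟩ := ih V
    have hnot : a ∉ s := fun h => lt_irrefl _ (has a h)
    have hK : ∃ K : ℝ, ∀ v ∈ V, 0 < v a → 0 < K * v a + ∑ c ∈ s, w c * v c := by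
      have : ∀ᶠ K : ℝ in Filter.atTop, ∀ v ∈ V,
          0 < v a → 0 < K * v a + ∑ c ∈ s, w c * v c := by
        rw [Filter.eventually_all_finset]
        intro v _
        by_cases h : 0 < v a
        · have ht : Filter.Tendsto (fun K : ℝ => K * v a + ∑ c ∈ s, w c * v c)
              Filter.atTop Filter.atTop :=
            Filter.tendsto_atTop_add_const_right _ _ (Filter.tendsto_id.atTop_mul_const h)
          filter_upwards [ht.eventually_gt_atTop 0] with K hK _ using hK
        · exact Filter.Eventually.of_forall fun K h' => absurd h' h
      exact this.exists
    obtain ⟨K, hK⟩ := hK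
    refine ⟨fun c => if c = a then K else w c, ?_⟩
    rintro v hv ⟨c, hc, hc0, hcp⟩
    rw [Finset.sum_insert hnot]
    have e : ∑ x ∈ s, (if x = a then K else w x) * v x = ∑ x ∈ s, w x * v x := by
      apply Finset.sum_congr rfl
      intro x hx
      rw [if_neg]
      rintro rfl
      exact hnot hx
    rw [e]
    simp only [if_true]
    rcases Finset.mem_insert.1 hc with rfl | hcs
    · exact hK v hv hcp
    · rw [hc0 a (has c hcs), mul_zero, zero_add]
      exact hw v hv ⟨c, hcs, hc0, hcp⟩

theorem hoopaux_group {G : Type*} [AddCommGroup G] [LinearOrder G] [IsOrderedAddMonoid G]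
    (P : Finset G) : ∃ φ : G → ℝ, (∀ x y, φ (x + y) = φ x + φ y) ∧
      ∀ x ∈ P, 0 < x → 0 < φ x := by
  classical
  obtain ⟨f, hf, -⟩ := hahnEmbedding_isOrderedAddMonoid G
  have hpos : ∀ x : G, 0 < x → ∃ i, (∀ j < i, (ofLex (f x)).coeff j = 0) ∧
      0 < (ofLex (f x)).coeff i := by
    intro x hx
    have h : f 0 < f x := (f.monotone'.strictMono_of_injective hf) hx
    rw [map_zero, HahnSeries.lt_iff] at h
    obtain ⟨i, h1, h2⟩ := h
    exact ⟨i, fun j hj => by simpa using (h1 j hj).symm, by simpa using h2⟩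
  by_cases hne : ∃ x : G, 0 < x
  swap
  · exact ⟨0, by simp, fun x _ hx => absurd ⟨x, hx⟩ hne⟩
  have : Nonempty (FiniteArchimedeanClass G) := hne.elim fun x hx => ⟨(hpos x hx).choose⟩
  choose! o ho1 ho2 using hpos
  obtain ⟨w, hw⟩ := hoopaux_weights ((P.filter (0 < ·)).image o)
    (P.image fun x => (ofLex (f x)).coeff)
  refine ⟨fun x => ∑ c ∈ (P.filter (0 < ·)).image o, w c * (ofLex (f x)).coeff c, ?_, ?_⟩
  · intro x y
    simp [mul_add, Finset.sum_add_distrib]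
  · intro x hx hx0
    exact hw _ (Finset.mem_image_of_mem _ hx)
      ⟨o x, Finset.mem_image_of_mem _ (Finset.mem_filter.2 ⟨hx, hx0⟩), ho1 x hx0, ho2 x hx0⟩

theorem hoopaux_monoid {A : Type*} [AddCommMonoid A] [LinearOrder A] [IsOrderedCancelAddMonoid A]
    (P : Finset A) : ∃ φ : A → ℝ, (∀ x y, φ (x + y) = φ x + φ y) ∧
      ∀ x ∈ P, 0 < x → 0 < φ x := by
  classical
  have : IsOrderedAddMonoid (Algebra.GrothendieckAddGroup A) := inferInstance
  let ι : A → Algebra.GrothendieckAddGroup A := fun a => AddLocalization.mk a 0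
  obtain ⟨φ, h1, h2⟩ := hoopaux_group (P.image ι)
  refine ⟨fun a => φ (ι a), ?_, ?_⟩
  · intro x y
    rw [← h1]
    congr 1
    simp [ι, AddLocalization.mk_add]
  · intro x hx h0
    apply h2 _ (Finset.mem_image_of_mem _ hx)
    rw [← AddLocalization.mk_zero]
    change AddLocalization.mk 0 0 < AddLocalization.mk x 0
    rw [AddLocalization.mk_lt_mk]
    simpa using h0

theorem hoopaux_hoop {α : Type*}
    (mul imp : α → α → α) (one : α)
    (hcomm : ∀ x y, mul x y = mul y x)
    (hassoc : ∀ x y z, mul (mul x y) z = mul x (mul y z))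
    (hone : ∀ x, mul x one = x)
    (hdivv : ∀ x y, mul x (imp x y) = mul y (imp y x))
    (hcanc : ∀ x y, imp y (mul x y) = x)
    (htot : ∀ x y, imp x y = one ∨ imp y x = one) (P : Finset α) :
    ∃ φ : α → ℝ, (∀ x y, φ (mul x y) = φ x + φ y) ∧ ∀ x ∈ P, x ≠ one → 0 < φ x := by
  classical
  have hc : ∀ x y z, mul x y = mul x z → y = z := by
    intro x y z h
    rw [← hcanc y x, hcomm, h, hcomm, hcanc]
  have h1 : ∀ w, imp one w = w := fun w => by
    have := hcanc w one
    rwa [hone] at this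
  have htop : ∀ w, imp w one = one := by
    intro w
    rcases htot w one with h | h
    · exact h
    · rw [h1] at h
      rw [h, h1]
  have hunit : ∀ z w, mul z w = one → z = one := by
    intro z w h
    rw [← hcanc z w, h, htop]
  letI : Zero α := ⟨one⟩
  letI : Add α := ⟨mul⟩
  letI : AddCommMonoid α :=
    { add_assoc := hassoc
      zero_add := fun x => (hcomm _ _).trans (hone x)
      add_zero := hone
      add_comm := hcomm
      nsmul := nsmulRec }
  letI : LinearOrder α :=
    { le := fun x y => ∃ z, mul x z = y
      le_refl := fun x => ⟨one, hone x⟩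
      le_trans := by
        rintro x _ _ ⟨a, rfl⟩ ⟨b, rfl⟩
        exact ⟨mul a b, (hassoc _ _ _).symm⟩
      le_antisymm := by
        rintro x _ ⟨a, rfl⟩ ⟨b, h⟩
        rw [hassoc] at h
        have := hunit a b (hc x _ _ (h.trans (hone x).symm))
        rw [this, hone]
      le_total := by
        intro x y
        rcases htot x y with h | h
        · right
          exact ⟨imp y x, by rw [← hdivv, h, hone]⟩
        · left
          exact ⟨imp x y, by rw [hdivv, h, hone]⟩
      toDecidableLE := Classical.decRel _ }
  have : IsOrderedCancelAddMonoid α :=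
    { add_le_add_left := by
        rintro x _ ⟨a, rfl⟩ c
        refine ⟨a, ?_⟩
        change mul (mul x c) a = mul (mul x a) c
        rw [hassoc, hassoc, hcomm c]
      le_of_add_le_add_left := by
        rintro x y z ⟨a, h⟩
        refine ⟨a, hc x _ _ ?_⟩
        rw [← hassoc]
        exact h }
  obtain ⟨φ, ha, hb⟩ := hoopaux_monoid P
  refine ⟨φ, ha, fun x hx hx1 => hb x hx (lt_of_le_of_ne ⟨x, ?_⟩ (Ne.symm hx1))⟩
  exact (hcomm _ _).trans (hone x)

/-- Every countable totally ordered cancellative hoop partially embeds into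
the standard cancellative hoop `(0,1]_C`: for every finite subset `F` there is
an injective map `f : F → (0,1]` with `f 1 = 1` whenever `1 ∈ F`,
`f (x*y) = f x · f y` whenever `x, y, x*y ∈ F`, and
`f (x⇒y) = min 1 (f y / f x)` whenever `x, y, x⇒y ∈ F`. -/
theorem countable_cancellative_hoop_partially_embeds {α : Type*} [Countable α]
    (mul imp : α → α → α) (one : α)
    (hcomm : ∀ x y, mul x y = mul y x)
    (hassoc : ∀ x y z, mul (mul x y) z = mul x (mul y z))
    (hone : ∀ x, mul x one = x)
    (hself : ∀ x, imp x x = one)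
    (hcurry : ∀ x y z, imp x (imp y z) = imp (mul x y) z)
    (hdivv : ∀ x y, mul x (imp x y) = mul y (imp y x))
    (hcanc : ∀ x y, imp y (mul x y) = x)
    (htot : ∀ x y, imp x y = one ∨ imp y x = one) :
    ∀ F : Finset α, ∃ f : α → ℝ,
      (∀ x ∈ F, f x ∈ Set.Ioc (0 : ℝ) 1) ∧
      Set.InjOn f ↑F ∧
      (one ∈ F → f one = 1) ∧
      (∀ x ∈ F, ∀ y ∈ F, mul x y ∈ F → f (mul x y) = f x * f y) ∧
      (∀ x ∈ F, ∀ y ∈ F, imp x y ∈ F → f (imp x y) = min 1 (f y / f x)) := by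
  classical
  intro F
  obtain ⟨φ, ha, hp⟩ := hoopaux_hoop mul imp one hcomm hassoc hone hdivv hcanc htot
    (F ∪ (F ×ˢ F).image fun p => imp p.1 p.2)
  have h0 : φ one = 0 := by
    have := ha one one
    rw [hone] at this
    linarith
  have hF : ∀ x ∈ F, x ≠ one → 0 < φ x := fun x hx => hp x (Finset.mem_union_left _ hx)
  have hI : ∀ x ∈ F, ∀ y ∈ F, imp x y ≠ one → 0 < φ (imp x y) := fun x hx y hy =>
    hp _ (Finset.mem_union_right _
      (Finset.mem_image.2 ⟨(x, y), Finset.mem_product.2 ⟨hx, hy⟩, rfl⟩))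
  have hI0 : ∀ x ∈ F, ∀ y ∈ F, 0 ≤ φ (imp x y) := by
    intro x hx y hy
    by_cases h : imp x y = one
    · rw [h, h0]
    · exact (hI x hx y hy h).le
  have hd : ∀ x y, φ x + φ (imp x y) = φ y + φ (imp y x) := by
    intro x y
    rw [← ha, ← ha, hdivv]
  refine ⟨fun x => Real.exp (-φ x), ?_, ?_, ?_, ?_, ?_⟩
  · intro x hx
    refine ⟨Real.exp_pos _, Real.exp_le_one_iff.2 ?_⟩
    by_cases h : x = one
    · rw [h, h0, neg_zero]
    · linarith [hF x hx h]
  · intro x hx y hy hxy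
    have hxy' : φ x = φ y := neg_injective (Real.exp_injective hxy)
    have e := hd x y
    have e1 : imp x y = one ∧ imp y x = one := by
      rcases htot x y with h | h
      · refine ⟨h, ?_⟩
        by_contra h'
        have := hI y hy x hx h'
        rw [h, h0] at e
        linarith
      · refine ⟨?_, h⟩
        by_contra h'
        have := hI x hx y hy h'
        rw [h, h0] at e
        linarith
    have := hdivv x y
    rwa [e1.1, e1.2, hone, hone] at this
  · intro _
    simp [h0]
  · intro x _ y _ _
    simp only [ha]
    rw [← Real.exp_add]
    congr 1
    ring
  · intro x hx y hy _
    have e := hd x y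
    simp only
    rw [← Real.exp_sub]
    rcases htot x y with h | h
    · rw [h, h0] at e
      have := hI0 y hy x hx
      rw [h, h0, neg_zero, Real.exp_zero, min_eq_left]
      exact Real.one_le_exp (by linarith)
    · rw [h, h0] at e
      have := hI0 x hx y hy
      rw [min_eq_right (Real.exp_le_one_iff.2 (by linarith))]
      congr 1
      linarith
end

section
/- Every countable perfect MV-chain partially embeds into V, the disconnected rotation of the standard cancellative hoop (0,1]_C: for every finite subset F of a countable perfect MV-chain A there is an injective map f : F → V preserving 0, 1, * and ⇒ wherever defined within F (i.e. f(0) = 0_V and f(1) = 1_V when 0, 1 ∈ F, f(x*y) = f(x)*_V f(y) whenever x, y, x*y ∈ F, and f(x⇒y) = f(x)⇒_V f(y) whenever x, y, x⇒y ∈ F). -/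
/-- Monoid operation of `V`, the disconnected rotation of the standard
cancellative hoop `(0,1]_C`, coded on `ℝ × Bool` (`(a, true)` for the upper
copy, `(a, false)` for the rotated lower copy; top `(1, true)`, bottom
`(1, false)`). -/
noncomputable def Vmul : ℝ × Bool → ℝ × Bool → ℝ × Bool
  | (a, true), (b, true) => (a * b, true)
  | (a, true), (b, false) => (min 1 (b / a), false)
  | (a, false), (b, true) => (min 1 (a / b), false)
  | (_, false), (_, false) => (1, false)

/-- Residuum of `V`. -/
noncomputable def Vimp : ℝ × Bool → ℝ × Bool → ℝ × Bool
  | (a, true), (b, true) => (min 1 (b / a), true)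
  | (a, true), (b, false) => (a * b, false)
  | (_, false), (_, true) => (1, true)
  | (a, false), (b, false) => (min 1 (a / b), true)

theorem aux_functional {M Γ : Type*} [AddCommGroup M] [LinearOrder Γ]
    (c : Γ → M →+ ℝ) (i : M → Γ) (P : Finset M)
    (h : ∀ p ∈ P, (∀ j, j < i p → c j p = 0) ∧ 0 < c (i p) p) :
    ∃ φ : M →+ ℝ, ∀ p ∈ P, 0 < φ p := by
  classical
  induction P using Finset.induction_on_min_value i with
  | empty => exact ⟨0, by simp⟩
  | insert a s has hmin ih =>
    obtain ⟨φ, hφ⟩ := ih (fun p hp => h p (Finset.mem_insert_of_mem hp))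
    obtain ⟨h1, h2⟩ := h a (Finset.mem_insert_self a s)
    obtain ⟨n, hn⟩ := Archimedean.arch (1 - φ a) h2
    refine ⟨φ + n • c (i a), ?_⟩
    intro p hp
    simp only [AddMonoidHom.add_apply, AddMonoidHom.smul_apply]
    rcases Finset.mem_insert.1 hp with rfl | hp'
    · linarith
    · have h3 : 0 ≤ c (i a) p := by
        rcases (hmin p hp').lt_or_eq with hlt | heq
        · exact ((h p hp).1 _ hlt).ge
        · rw [heq]; exact (h p hp).2.le
      have := hφ p hp'
      have : 0 ≤ n • c (i a) p := nsmul_nonneg h3 n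
      linarith

theorem aux_group {M : Type*} [AddCommGroup M] [LinearOrder M] [IsOrderedAddMonoid M]
    (P : Finset M) (h : ∀ p ∈ P, 0 < p) :
    ∃ φ : M →+ ℝ, ∀ p ∈ P, 0 < φ p := by
  classical
  obtain ⟨f, hf, -⟩ := hahnEmbedding_isOrderedAddMonoid M
  have key : ∀ p : M, 0 < p → ∃ i, (∀ j, j < i → (ofLex (f p)).coeff j = 0) ∧
      0 < (ofLex (f p)).coeff i := by
    intro p hp
    have h1 : f 0 < f p := lt_of_le_of_ne (f.monotone' hp.le) (fun e => hp.ne (hf e))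
    rw [map_zero, HahnSeries.lt_iff] at h1
    obtain ⟨i, hi, hi'⟩ := h1
    exact ⟨i, fun j hj => (hi j hj).symm, hi'⟩
  rcases P.eq_empty_or_nonempty with rfl | ⟨p0, hp0⟩
  · exact ⟨0, by simp⟩
  have : Nonempty (FiniteArchimedeanClass M) := ⟨(key p0 (h p0 hp0)).choose⟩
  choose! i hi using key
  let c : FiniteArchimedeanClass M → M →+ ℝ := fun j =>
    { toFun := fun p => (ofLex (f p)).coeff j
      map_zero' := by simp
      map_add' := by intro x y; simp }
  exact aux_functional c i P (fun p hp => hi p (h p hp))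

theorem aux_monoid {S : Type*} [CommMonoid S] [LinearOrder S] [IsOrderedCancelMonoid S]
    (K : Finset S) : ∃ g : S → ℝ, (∀ x, 0 < g x) ∧ (∀ x y, g (x * y) = g x * g y) ∧
      ∀ x ∈ K, ∀ y ∈ K, x < y → g x < g y := by
  classical
  let e : S → Additive (Algebra.GrothendieckGroup S) := fun x =>
    Additive.ofMul (Localization.mk x 1)
  have emul : ∀ x y, e (x * y) = e x + e y := by
    intro x y
    simp only [e, ← ofMul_mul, Localization.mk_mul, mul_one]
  have elt : ∀ x y, x < y → e x < e y := by
    intro x y hxy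
    exact (Localization.mkOrderEmbedding (1 : (⊤ : Submonoid S))).lt_iff_lt.2 hxy
  have : IsOrderedAddMonoid (Additive (Algebra.GrothendieckGroup S)) := inferInstance
  obtain ⟨φ, hφ⟩ := aux_group
    (((K ×ˢ K).filter (fun q => q.1 < q.2)).image (fun q => e q.2 - e q.1)) (by
      intro p hp
      simp only [Finset.mem_image, Finset.mem_filter] at hp
      obtain ⟨q, ⟨-, hq⟩, rfl⟩ := hp
      exact sub_pos.2 (elt _ _ hq))
  refine ⟨fun x => Real.exp (φ (e x)), fun x => Real.exp_pos _, ?_, ?_⟩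
  · intro x y
    simp only [emul, map_add, Real.exp_add]
  · intro x hx y hy hxy
    have := hφ (e y - e x) (Finset.mem_image.2 ⟨(x, y), by simp [hx, hy, hxy], rfl⟩)
    rw [map_sub] at this
    exact Real.exp_lt_exp.2 (by linarith)

theorem aux_rad {α : Type*} [LinearOrder α] [BoundedOrder α] (mul : α → α → α) (R : α → Prop)
    (hcomm : ∀ x y, mul x y = mul y x)
    (hassoc : ∀ x y z, mul (mul x y) z = mul x (mul y z))
    (hone : ∀ x, mul x ⊤ = x)
    (hRtop : R ⊤) (hRmul : ∀ x y, R x → R y → R (mul x y))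
    (hmono : ∀ x y z, x ≤ y → mul z x ≤ mul z y)
    (hcan : ∀ x y z, R x → R y → R z → mul x y ≤ mul x z → y ≤ z)
    (K : Finset α) : ∃ g : α → ℝ, (∀ x, R x → 0 < g x) ∧ g ⊤ = 1 ∧
      (∀ x y, R x → R y → g (mul x y) = g x * g y) ∧
      ∀ x ∈ K, ∀ y ∈ K, R x → R y → x < y → g x < g y := by
  classical
  let : CommMonoid {x // R x} :=
    { mul := fun a b => ⟨mul a.1 b.1, hRmul _ _ a.2 b.2⟩
      one := ⟨⊤, hRtop⟩
      mul_assoc := fun a b c => Subtype.ext (hassoc _ _ _)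
      mul_comm := fun a b => Subtype.ext (hcomm _ _)
      mul_one := fun a => Subtype.ext (hone _)
      one_mul := fun a => Subtype.ext ((hcomm _ _).trans (hone _)) }
  have : IsOrderedCancelMonoid {x // R x} :=
    { mul_le_mul_left := fun a b hab c => by
        change mul a.1 c.1 ≤ mul b.1 c.1
        rw [hcomm a.1, hcomm b.1]
        exact hmono _ _ _ hab
      le_of_mul_le_mul_left := fun a b c h => hcan a.1 b.1 c.1 a.2 b.2 c.2 h }
  obtain ⟨g, hg0, hgm, hglt⟩ := aux_monoid (K.subtype R)
  have e : ∀ x (h : R x), (if h : R x then g ⟨x, h⟩ else 0) = g ⟨x, h⟩ := fun x h => dif_pos h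
  refine ⟨fun x => if h : R x then g ⟨x, h⟩ else 0, ?_, ?_, ?_, ?_⟩
  · intro x hx
    simp only [e x hx]; exact hg0 _
  · simp only [e ⊤ hRtop]
    have h1 := hgm 1 1
    rw [mul_one] at h1
    have h2 := hg0 1
    change g 1 = 1
    exact mul_left_cancel₀ h2.ne' (by rw [← h1, mul_one])
  · intro x y hx hy
    simp only [e _ hx, e _ hy, e _ (hRmul x y hx hy)]
    exact hgm ⟨x, hx⟩ ⟨y, hy⟩
  · intro x hxK y hyK hx hy hxy
    simp only [e _ hx, e _ hy]
    exact hglt _ (by simpa using hxK) _ (by simpa using hyK) hxy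

/-- Every countable perfect MV-chain partially embeds into `V`, the
disconnected rotation of the standard cancellative hoop `(0,1]_C`: for every
finite subset `F` there is an injective map `f : F → V` preserving `0`, `1`,
`*` and `⇒` wherever defined within `F`. -/
theorem countable_perfect_MV_chain_partially_embeds_in_V {α : Type*}
    [Countable α] [LinearOrder α] [BoundedOrder α]
    (mul imp : α → α → α)
    (hcomm : ∀ x y, mul x y = mul y x)
    (hassoc : ∀ x y z, mul (mul x y) z = mul x (mul y z))
    (hone : ∀ x, mul x ⊤ = x)
    (hres : ∀ x y z : α, mul z x ≤ y ↔ z ≤ imp x y)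
    (hprel : ∀ x y, imp x y ⊔ imp y x = ⊤)
    (hdiv : ∀ x y, x ⊓ y = mul x (imp x y))
    (hinv : ∀ x, imp (imp x ⊥) ⊥ = x)
    (hperf : ∀ x : α, (∃ n, 1 ≤ n ∧ hpow mul (⊤ : α) x n = ⊥) ↔
      ¬ ∃ n, 1 ≤ n ∧ hpow mul (⊤ : α) (imp x ⊥) n = ⊥) :
    ∀ F : Finset α, ∃ f : α → ℝ × Bool,
      (∀ x ∈ F, 0 < (f x).1 ∧ (f x).1 ≤ 1) ∧
      Set.InjOn f ↑F ∧
      ((⊥ : α) ∈ F → f ⊥ = (1, false)) ∧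
      ((⊤ : α) ∈ F → f ⊤ = (1, true)) ∧
      (∀ x ∈ F, ∀ y ∈ F, mul x y ∈ F → f (mul x y) = Vmul (f x) (f y)) ∧
      (∀ x ∈ F, ∀ y ∈ F, imp x y ∈ F → f (imp x y) = Vimp (f x) (f y)) := by
  classical
  intro F
  have htop : ∀ x, mul ⊤ x = x := fun x => (hcomm _ _).trans (hone x)
  have hmono : ∀ x y z, x ≤ y → mul z x ≤ mul z y := by
    intro x y z hxy
    rw [hcomm z x, hres]
    exact hxy.trans ((hres _ _ _).1 (hcomm y z).le)
  have hmono2 : ∀ x y z w, x ≤ y → z ≤ w → mul x z ≤ mul y w := by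
    intro x y z w h1 h2
    refine (hmono _ _ _ h2).trans ?_
    rw [hcomm x, hcomm y]
    exact hmono _ _ _ h1
  have himp1 : ∀ x y, x ≤ y → imp x y = ⊤ := by
    intro x y hxy
    exact top_le_iff.1 ((hres _ _ _).1 (by rw [htop]; exact hxy))
  have hcurry : ∀ x y z, imp (mul x y) z = imp x (imp y z) := by
    intro x y z
    apply eq_of_forall_le_iff
    intro w
    rw [← hres, ← hres, ← hres, hassoc]
  -- negation
  have hnm : ∀ x y, imp (mul x y) ⊥ = imp x (imp y ⊥) := fun x y => hcurry x y ⊥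
  have himpn : ∀ x y, imp x y = imp (mul x (imp y ⊥)) ⊥ := by
    intro x y
    rw [hnm, hinv]
  have hcontra : ∀ x y, imp x y = imp (imp y ⊥) (imp x ⊥) := by
    intro x y
    rw [himpn, hcomm, hnm]
  have hnbot : imp ⊥ ⊥ = (⊤ : α) := himp1 _ _ le_rfl
  let R : α → Prop := fun x => ¬ ∃ n, 1 ≤ n ∧ hpow mul (⊤ : α) x n = ⊥
  have hRn : ∀ x, ¬ R x ↔ R (imp x ⊥) := by
    intro x
    simp only [R, not_not]
    exact hperf x
  have hpmono : ∀ x y, x ≤ y → ∀ n, hpow mul ⊤ x n ≤ hpow mul ⊤ y n := by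
    intro x y hxy n
    induction n with
    | zero => exact le_rfl
    | succ n ih => exact hmono2 _ _ _ _ hxy ih
  have hRup : ∀ x y, x ≤ y → R x → R y := by
    rintro x y hxy hx ⟨n, hn, h⟩
    exact hx ⟨n, hn, le_bot_iff.1 (h ▸ hpmono x y hxy n)⟩
  have hRbot : ¬ R ⊥ := fun h => h ⟨1, le_rfl, hone _⟩
  have hRtop : R ⊤ := by
    rw [← hnbot]
    exact (hRn _).1 hRbot
  have hsq : ∀ x n, hpow mul ⊤ (mul x x) n = hpow mul ⊤ x (2 * n) := by
    intro x n
    induction n with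
    | zero => rfl
    | succ n ih =>
      change mul (mul x x) _ = mul x (mul x (hpow mul ⊤ x (2 * n)))
      rw [ih, hassoc]
  have hRsq : ∀ x, R x → R (mul x x) := by
    rintro x hx ⟨n, hn, h⟩
    exact hx ⟨2 * n, by omega, by rw [← hsq, h]⟩
  have hRmul : ∀ x y, R x → R y → R (mul x y) := by
    intro x y hx hy
    rcases le_total x y with h | h
    · exact hRup _ _ (hmono _ _ _ h) (hRsq x hx)
    · exact hRup _ _ (hmono2 _ _ _ _ h le_rfl) (hRsq y hy)
  have hlt : ∀ x y, R x → ¬ R y → y ≤ x := by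
    intro x y hx hy
    by_contra hc
    exact hy (hRup _ _ (not_le.1 hc).le hx)
  have hRnn : ∀ x, R x → ¬ R (imp x ⊥) := fun x hx h => (hRn x).2 h hx
  have hback : ∀ x y, R x → R y → imp x (mul x y) = y := by
    intro x y hx hy
    rw [himpn, hnm x y, ← hdiv, inf_eq_right.2 (hlt _ _ hx (hRnn y hy)), hinv]
  have hcan : ∀ x y z, R x → R y → R z → mul x y ≤ mul x z → y ≤ z := by
    intro x y z hx hy hz h
    rw [← hback x z hx hz, ← hres, hcomm]
    exact h
  obtain ⟨g, hg0, hg1, hgm, hglt⟩ := aux_rad mul R hcomm hassoc hone hRtop hRmul hmono hcan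
    (insert ⊤ (F ∪ F.image (fun x => imp x ⊥)))
  set K := insert ⊤ (F ∪ F.image (fun x => imp x ⊥)) with hK
  have hKF : ∀ x ∈ F, x ∈ K := fun x hx => by simp [hK, hx]
  have hKn : ∀ x ∈ F, imp x ⊥ ∈ K := fun x hx =>
    Finset.mem_insert_of_mem (Finset.mem_union_right _ (Finset.mem_image_of_mem _ hx))
  have hKt : ⊤ ∈ K := Finset.mem_insert_self _ _
  have hgle : ∀ x ∈ K, ∀ y ∈ K, R x → R y → x ≤ y → g x ≤ g y := by
    intro x hx y hy hRx hRy hxy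
    rcases hxy.lt_or_eq with h | h
    · exact (hglt x hx y hy hRx hRy h).le
    · rw [h]
  have hginj : ∀ x ∈ K, ∀ y ∈ K, R x → R y → g x = g y → x = y := by
    intro x hx y hy hRx hRy hxy
    rcases lt_trichotomy x y with h | h | h
    · exact absurd hxy (hglt x hx y hy hRx hRy h).ne
    · exact h
    · exact absurd hxy (hglt y hy x hx hRy hRx h).ne'
  have hgi : ∀ x ∈ K, ∀ z ∈ K, R x → R z → g (imp x z) = min 1 (g z / g x) := by
    intro x hx z hz hRx hRz
    have hx0 := hg0 x hRx
    rcases le_total x z with h | h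
    · rw [himp1 _ _ h, hg1, min_eq_left]
      rw [le_div_iff₀ hx0, one_mul]
      exact hgle x hx z hz hRx hRz h
    · have h1 : R (imp x z) := by
        refine hRup z _ ?_ hRz
        rw [← hres]
        exact (hmono _ _ _ le_top).trans (hone z).le
      have h2 := hgm x (imp x z) hRx h1
      rw [← hdiv, inf_eq_right.2 h] at h2
      rw [min_eq_right]
      · rw [eq_div_iff hx0.ne', h2, mul_comm]
      · rw [div_le_one hx0]
        exact hgle z hz x hx hRz hRx h
  let f : α → ℝ × Bool := fun x => if R x then (g x, true) else (g (imp x ⊥), false)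
  have fp : ∀ x, R x → f x = (g x, true) := fun x h => if_pos h
  have fn : ∀ x, ¬ R x → f x = (g (imp x ⊥), false) := fun x h => if_neg h
  have hmulle : ∀ x y, mul x y ≤ y := fun x y => by
    rw [hcomm]; exact (hmono _ _ _ le_top).trans (hone y).le
  have hmixed : ∀ x ∈ F, ∀ y ∈ F, R x → ¬ R y →
      f (mul x y) = (min 1 (g (imp y ⊥) / g x), false) := by
    intro x hx y hy hRx hRy
    rw [fn _ (fun h => hRy (hRup _ _ (hmulle x y) h)), hnm,
      hgi x (hKF x hx) _ (hKn y hy) hRx ((hRn y).1 hRy)]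
  refine ⟨f, ?_, ?_, ?_, ?_, ?_, ?_⟩
  · intro x hx
    by_cases h : R x
    · rw [fp x h]
      exact ⟨hg0 x h, hg1 ▸ hgle x (hKF x hx) ⊤ hKt h hRtop le_top⟩
    · rw [fn x h]
      have h' := (hRn x).1 h
      exact ⟨hg0 _ h', hg1 ▸ hgle _ (hKn x hx) ⊤ hKt h' hRtop le_top⟩
  · intro x hx y hy hxy
    by_cases h : R x <;> by_cases h' : R y
    · rw [fp x h, fp y h'] at hxy
      exact hginj x (hKF x hx) y (hKF y hy) h h' (Prod.ext_iff.1 hxy).1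
    · rw [fp x h, fn y h'] at hxy
      simp at hxy
    · rw [fn x h, fp y h'] at hxy
      simp at hxy
    · rw [fn x h, fn y h'] at hxy
      have := hginj _ (hKn x hx) _ (hKn y hy) ((hRn x).1 h) ((hRn y).1 h') (Prod.ext_iff.1 hxy).1
      rw [← hinv x, this, hinv]
  · intro _
    rw [fn _ hRbot, hnbot, hg1]
  · intro _
    rw [fp _ hRtop, hg1]
  · intro x hx y hy _
    by_cases h : R x <;> by_cases h' : R y
    · rw [fp x h, fp y h', fp _ (hRmul x y h h'), hgm x y h h']
      rfl
    · rw [hmixed x hx y hy h h', fp x h, fn y h']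
      rfl
    · rw [hcomm, hmixed y hy x hx h' h, fn x h, fp y h']
      rfl
    · have h0 : mul x y = ⊥ := by
        rw [← le_bot_iff, hres]
        exact hlt _ _ ((hRn y).1 h') h
      rw [h0, fn _ hRbot, hnbot, hg1, fn x h, fn y h']
      rfl
  · intro x hx y hy _
    by_cases h : R x <;> by_cases h' : R y
    · have h1 : R (imp x y) := hRup y _ ((hres _ _ _).1
        ((hmono _ _ _ le_top).trans (hone y).le)) h'
      rw [fp _ h1, hgi x (hKF x hx) y (hKF y hy) h h', fp x h, fp y h']
      rfl
    · have h2 := (hRn y).1 h'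
      have h1 : ¬ R (imp x y) := by
        rw [himpn]
        exact hRnn _ (hRmul _ _ h h2)
      rw [fn _ h1, himpn x y, hinv, hgm _ _ h h2, fp x h, fn y h']
      rfl
    · rw [himp1 _ _ (hlt _ _ h' h), fp _ hRtop, hg1, fn x h, fp y h']
      rfl
    · have hx' := (hRn x).1 h
      have hy' := (hRn y).1 h'
      have h1 : R (imp (imp y ⊥) (imp x ⊥)) := hRup _ _ ((hres _ _ _).1
        ((hmono _ _ _ le_top).trans (hone (imp x ⊥)).le)) hx'
      rw [hcontra x y, fp _ h1, hgi _ (hKn y hy) _ (hKn x hx) hy' hx', fn x h, fn y h']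
      rfl
end
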